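/- arXiv:2507.09661 — 8 statements merged into one kernel-verified Lean document; each statement's English description precedes it below -/
import Mathlib

section
/- For every i with 1 ≤ i ≤ k, the leading coefficient matrix satisfies A · B_{i,r_i} = λ_i · B_{i,r_i}; equivalently, (λ_i I − A) B_{i,r_i} = 0. -/
open Matrix Polynomial

/-- The leading coefficient satisfies `A * B i (r i) = lam i • B i (r i)`. -/
theorem leading_coefficient_eigen
    (n k : ℕ) (hn : 1 ≤ n)
    (A : Matrix (Fin n) (Fin n) ℂ)
    (lam : Fin k → ℂ) (hlam : Function.Injective lam)
    (r : Fin k → ℕ) (hr : ∀ i, 1 ≤ r i)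
    (hsum : ∑ i, r i = n)
    (hchar : A.charpoly = ∏ i, (X - C (lam i)) ^ r i)
    (B : Fin k → ℕ → Matrix (Fin n) (Fin n) ℂ)
    (hB : ∀ s : ℂ, (∀ i, s ≠ lam i) →
      (s • (1 : Matrix (Fin n) (Fin n) ℂ) - A)⁻¹
        = ∑ i, ∑ j ∈ Finset.Icc 1 (r i), ((s - lam i) ^ j)⁻¹ • B i j)
    :
    ∀ i : Fin k, A * B i (r i) = lam i • B i (r i) := by
  intro i
  have hdet : ∀ s : ℂ, (∀ l, s ≠ lam l) →
      IsUnit (s • (1 : Matrix (Fin n) (Fin n) ℂ) - A).det := by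
    intro s hs
    have h1 : (s • (1 : Matrix (Fin n) (Fin n) ℂ) - A).det = A.charpoly.eval s := by
      rw [Matrix.eval_charpoly, Matrix.smul_one_eq_diagonal]
      rfl
    rw [h1, hchar, Polynomial.eval_prod, isUnit_iff_ne_zero]
    refine Finset.prod_ne_zero_iff.mpr fun l _ => ?_
    simp only [eval_pow, eval_sub, eval_X, eval_C]
    exact pow_ne_zero _ (sub_ne_zero.mpr (hs l))
  have hev : ∀ᶠ s in nhdsWithin (lam i) {lam i}ᶜ, ∀ l, s ≠ lam l := by
    rw [Filter.eventually_all]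
    intro l
    by_cases h : l = i
    · subst h
      exact self_mem_nhdsWithin
    · exact nhdsWithin_le_nhds (isOpen_ne.mem_nhds (fun e => h (hlam e.symm)))
  have hsub : Filter.Tendsto (fun s : ℂ => s - lam i) (nhdsWithin (lam i) {lam i}ᶜ) (nhds 0) := by
    have : Continuous (fun s : ℂ => s - lam i) := by fun_prop
    have h := this.tendsto (lam i)
    rw [sub_self] at h
    exact h.mono_left nhdsWithin_le_nhds
  have hpow : ∀ m : ℕ, m ≠ 0 → Filter.Tendsto (fun s : ℂ => (s - lam i) ^ m)
      (nhdsWithin (lam i) {lam i}ᶜ) (nhds 0) := by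
    intro m hm
    have := hsub.pow m
    rwa [zero_pow hm] at this
  have hcoef : ∀ l, ∀ j ∈ Finset.Icc 1 (r l), Filter.Tendsto
      (fun s : ℂ => (s - lam i) ^ r i * ((s - lam l) ^ j)⁻¹)
      (nhdsWithin (lam i) {lam i}ᶜ) (nhds (if l = i then (if j = r i then 1 else 0) else 0)) := by
    intro l j hj
    rw [Finset.mem_Icc] at hj
    by_cases h : l = i
    · subst h
      have heq : (fun s : ℂ => (s - lam l) ^ (r l - j)) =ᶠ[nhdsWithin (lam l) {lam l}ᶜ]
          (fun s : ℂ => (s - lam l) ^ r l * ((s - lam l) ^ j)⁻¹) := by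
        filter_upwards [hev] with s hs
        exact pow_sub₀ _ (sub_ne_zero.mpr (hs l)) hj.2
      refine Filter.Tendsto.congr' heq ?_
      by_cases hjr : j = r l
      · simp [hjr]
      · simp only [if_true, if_neg hjr]
        exact hpow _ (by omega)
    · rw [if_neg h]
      have hne : (lam i - lam l) ^ j ≠ 0 :=
        pow_ne_zero _ (sub_ne_zero.mpr fun e => h (hlam e.symm))
      have hc : Continuous (fun s : ℂ => (s - lam l) ^ j) := by fun_prop
      have h2 := ((hc.tendsto (lam i)).inv₀ hne).mono_left
        (nhdsWithin_le_nhds (s := {lam i}ᶜ))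
      have h3 := (hpow (r i) (by have := hr i; omega)).mul h2
      rwa [zero_mul] at h3
  have hG : Filter.Tendsto (fun s : ℂ => ∑ l, ∑ j ∈ Finset.Icc 1 (r l),
      ((s - lam i) ^ r i * ((s - lam l) ^ j)⁻¹) • B l j)
      (nhdsWithin (lam i) {lam i}ᶜ) (nhds (B i (r i))) := by
    have h := tendsto_finsetSum (Finset.univ : Finset (Fin k)) fun l _ =>
      tendsto_finsetSum (Finset.Icc 1 (r l)) fun j hj =>
        (hcoef l j hj).smul_const (B l j)
    have e : (∑ l, ∑ j ∈ Finset.Icc 1 (r l),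
        (if l = i then (if j = r i then (1 : ℂ) else 0) else 0) • B l j) = B i (r i) := by
      rw [Finset.sum_eq_single i]
      · rw [Finset.sum_eq_single (r i)]
        · simp
        · intro j _ hj
          simp [hj]
        · intro hj
          exact absurd (Finset.mem_Icc.mpr ⟨hr i, le_rfl⟩) hj
      · intro l _ hl
        simp [hl]
      · simp
    rwa [e] at h
  have hM : Filter.Tendsto (fun s : ℂ => s • (1 : Matrix (Fin n) (Fin n) ℂ) - A)
      (nhdsWithin (lam i) {lam i}ᶜ) (nhds (lam i • (1 : Matrix (Fin n) (Fin n) ℂ) - A)) := by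
    have : Continuous (fun s : ℂ => s • (1 : Matrix (Fin n) (Fin n) ℂ) - A) := by fun_prop
    exact (this.tendsto _).mono_left nhdsWithin_le_nhds
  have hL := hM.mul hG
  have hR : Filter.Tendsto (fun s : ℂ => (s - lam i) ^ r i • (1 : Matrix (Fin n) (Fin n) ℂ))
      (nhdsWithin (lam i) {lam i}ᶜ) (nhds 0) := by
    have := (hpow (r i) (by have := hr i; omega)).smul_const (1 : Matrix (Fin n) (Fin n) ℂ)
    rwa [zero_smul] at this
  have hLR := hR.congr' (f₂ := fun s : ℂ => (s • (1 : Matrix (Fin n) (Fin n) ℂ) - A) *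
      ∑ l, ∑ j ∈ Finset.Icc 1 (r l), ((s - lam i) ^ r i * ((s - lam l) ^ j)⁻¹) • B l j) (by
    filter_upwards [hev] with s hs
    have e : (∑ l, ∑ j ∈ Finset.Icc 1 (r l), ((s - lam i) ^ r i * ((s - lam l) ^ j)⁻¹) • B l j)
        = (s - lam i) ^ r i • (s • (1 : Matrix (Fin n) (Fin n) ℂ) - A)⁻¹ := by
      rw [hB s hs]
      simp only [Finset.smul_sum, smul_smul]
    rw [e, Matrix.mul_smul, Matrix.mul_nonsing_inv _ (hdet s hs)])
  have hfin := tendsto_nhds_unique hL hLR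
  rw [sub_mul, smul_mul_assoc, one_mul, sub_eq_zero] at hfin
  exact hfin.symm
end

section
/- For every i with 1 ≤ i ≤ k, if b is a nonzero column of the matrix B_{i,r_i}, then b is an eigenvector of A corresponding to the eigenvalue λ_i, i.e., A b = λ_i b and b ≠ 0. -/
open Matrix Polynomial

/-- Every nonzero column of `B i (r i)` is an eigenvector of `A` for `lam i`. -/
theorem nonzero_column_is_eigenvector
    (n k : ℕ) (hn : 1 ≤ n)
    (A : Matrix (Fin n) (Fin n) ℂ)
    (lam : Fin k → ℂ) (hlam : Function.Injective lam)
    (r : Fin k → ℕ) (hr : ∀ i, 1 ≤ r i)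
    (hsum : ∑ i, r i = n)
    (hchar : A.charpoly = ∏ i, (X - C (lam i)) ^ r i)
    (B : Fin k → ℕ → Matrix (Fin n) (Fin n) ℂ)
    (hB : ∀ s : ℂ, (∀ i, s ≠ lam i) →
      (s • (1 : Matrix (Fin n) (Fin n) ℂ) - A)⁻¹
        = ∑ i, ∑ j ∈ Finset.Icc 1 (r i), ((s - lam i) ^ j)⁻¹ • B i j)
    :
    ∀ i : Fin k, ∀ m : Fin n,
      (fun p => B i (r i) p m) ≠ 0 →
        A.mulVec (fun p => B i (r i) p m) = lam i • (fun p => B i (r i) p m) ∧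
          (fun p => B i (r i) p m) ≠ 0 := by
  intro i m hne
  refine ⟨?_, hne⟩
  have hev : ∀ᶠ s in nhdsWithin (lam i) {lam i}ᶜ, ∀ l, s ≠ lam l := by
    rw [Filter.eventually_all]
    intro l
    by_cases h : l = i
    · subst h
      exact eventually_mem_nhdsWithin
    · exact nhdsWithin_le_nhds (isOpen_ne.mem_nhds (fun e => h (hlam e).symm))
  have hself : ∀ᶠ s in nhdsWithin (lam i) {lam i}ᶜ, s - lam i ≠ 0 := by
    filter_upwards [hev] with s hs using sub_ne_zero.mpr (hs i)
  have hcoef : ∀ l, ∀ j ∈ Finset.Icc 1 (r l),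
      Filter.Tendsto (fun s : ℂ => (s - lam i) ^ r i * ((s - lam l) ^ j)⁻¹)
        (nhdsWithin (lam i) {lam i}ᶜ) (nhds (if l = i ∧ j = r i then 1 else 0)) := by
    intro l j hj
    rw [Finset.mem_Icc] at hj
    by_cases h : l = i
    · subst h
      by_cases h2 : j = r l
      · subst h2
        simp only [and_self, if_true]
        refine tendsto_const_nhds.congr' ?_
        filter_upwards [hself] with s hs
        rw [mul_inv_cancel₀ (pow_ne_zero _ hs)]
      · have hc : Filter.Tendsto (fun s : ℂ => (s - lam l) ^ (r l - j))
            (nhdsWithin (lam l) {lam l}ᶜ) (nhds 0) := by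
          have hcc : Continuous (fun s : ℂ => (s - lam l) ^ (r l - j)) := by fun_prop
          have := (hcc.tendsto (lam l)).mono_left (nhdsWithin_le_nhds (s := {lam l}ᶜ))
          simpa [zero_pow (show r l - j ≠ 0 by omega)] using this
        simp only [h2, and_false, if_false]
        refine hc.congr' ?_
        filter_upwards [hself] with s hs
        rw [pow_sub₀ _ hs hj.2]
    · have hne' : (lam i - lam l) ^ j ≠ 0 :=
        pow_ne_zero _ (sub_ne_zero.mpr (fun e => h (hlam e).symm))
      have hcc : ContinuousAt (fun s : ℂ => (s - lam i) ^ r i * ((s - lam l) ^ j)⁻¹) (lam i) :=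
        ContinuousAt.mul (by fun_prop) (ContinuousAt.inv₀ (by fun_prop) hne')
      have := hcc.tendsto.mono_left (nhdsWithin_le_nhds (s := {lam i}ᶜ))
      have hri := hr i
      simpa [h, zero_pow (show r i ≠ 0 by omega)] using this
  have hG : Filter.Tendsto (fun s : ℂ => ∑ l, ∑ j ∈ Finset.Icc 1 (r l),
      ((s - lam i) ^ r i * ((s - lam l) ^ j)⁻¹) • B l j)
      (nhdsWithin (lam i) {lam i}ᶜ) (nhds (B i (r i))) := by
    have h1 : B i (r i) = ∑ l, ∑ j ∈ Finset.Icc 1 (r l),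
        (if l = i ∧ j = r i then (1 : ℂ) else 0) • B l j := by
      rw [Finset.sum_eq_single i]
      · rw [Finset.sum_eq_single (r i)]
        · simp
        · intro j _ hj
          simp [hj]
        · intro h
          exact absurd (Finset.mem_Icc.mpr ⟨hr i, le_rfl⟩) h
      · intro l _ hl
        simp [hl]
      · simp
    rw [h1]
    exact tendsto_finsetSum _ fun l _ => tendsto_finsetSum _ fun j hj =>
      (hcoef l j hj).smul_const _
  have hL : Filter.Tendsto (fun s : ℂ => s • (1 : Matrix (Fin n) (Fin n) ℂ) - A)
      (nhdsWithin (lam i) {lam i}ᶜ) (nhds (lam i • (1 : Matrix (Fin n) (Fin n) ℂ) - A)) := by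
    have hcc : Continuous (fun s : ℂ => s • (1 : Matrix (Fin n) (Fin n) ℂ) - A) := by fun_prop
    exact (hcc.tendsto (lam i)).mono_left nhdsWithin_le_nhds
  have hR : Filter.Tendsto (fun s : ℂ => (s - lam i) ^ r i • (1 : Matrix (Fin n) (Fin n) ℂ))
      (nhdsWithin (lam i) {lam i}ᶜ) (nhds 0) := by
    have hcc : Continuous
        (fun s : ℂ => (s - lam i) ^ r i • (1 : Matrix (Fin n) (Fin n) ℂ)) := by fun_prop
    have := (hcc.tendsto (lam i)).mono_left (nhdsWithin_le_nhds (s := {lam i}ᶜ))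
    have hri := hr i
    simpa [zero_pow (show r i ≠ 0 by omega)] using this
  have hP := hL.mul hG
  have hzero : (lam i • (1 : Matrix (Fin n) (Fin n) ℂ) - A) * B i (r i) = 0 := by
    refine tendsto_nhds_unique hP (hR.congr' ?_)
    filter_upwards [hev] with s hs
    have hdet : IsUnit (s • (1 : Matrix (Fin n) (Fin n) ℂ) - A).det := by
      have h1 : (s • (1 : Matrix (Fin n) (Fin n) ℂ) - A).det = A.charpoly.eval s := by
        rw [Matrix.eval_charpoly, Matrix.scalar_apply, Matrix.smul_one_eq_diagonal]
      rw [h1, hchar, Polynomial.eval_prod, isUnit_iff_ne_zero, Finset.prod_ne_zero_iff]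
      intro l _
      simpa using fun h => absurd h (sub_ne_zero.mpr (hs l))
    have h2 : ∑ l, ∑ j ∈ Finset.Icc 1 (r l),
        ((s - lam i) ^ r i * ((s - lam l) ^ j)⁻¹) • B l j
        = (s - lam i) ^ r i • (s • (1 : Matrix (Fin n) (Fin n) ℂ) - A)⁻¹ := by
      rw [hB s hs]
      simp only [Finset.smul_sum, smul_smul]
    rw [h2, Matrix.mul_smul, Matrix.mul_nonsing_inv _ hdet]
  rw [sub_mul, smul_mul_assoc, one_mul, sub_eq_zero] at hzero
  ext p
  have := congrFun (congrFun hzero p) m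
  rw [Matrix.mul_apply] at this
  simpa [Matrix.mulVec, dotProduct] using this.symm
end

section
/- For every i with 1 ≤ i ≤ k and every j with 1 ≤ j ≤ r_i − 1, one has (A − λ_i I) · B_{i,j} = B_{i,j+1}. -/
open Matrix Polynomial

open Filter Topology in
theorem polar_part_unique {E : Type*} [AddCommGroup E] [Module ℂ E] [TopologicalSpace E]
    [IsTopologicalAddGroup E] [ContinuousSMul ℂ E] [T2Space E] (a : ℂ) (g : ℂ → E)
    (hg : ContinuousAt g a) (c : ℕ → E) (r : ℕ)
    (h : ∀ᶠ s in 𝓝[≠] a, ∑ j ∈ Finset.Icc 1 r, ((s - a) ^ j)⁻¹ • c j + g s = 0) :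
    ∀ j ∈ Finset.Icc 1 r, c j = 0 := by
  induction r with
  | zero => simp
  | succ r ih =>
    have hc : c (r + 1) = 0 := by
      let f : ℂ → E := fun s => ∑ j ∈ Finset.Icc 1 r, (s - a) ^ (r + 1 - j) • c j + c (r + 1)
        + (s - a) ^ (r + 1) • g s
      have hf : ContinuousAt f a := by
        have h1 : ContinuousAt (fun s : ℂ => ∑ j ∈ Finset.Icc 1 r, (s - a) ^ (r + 1 - j) • c j
            + c (r + 1)) a := by
          apply Continuous.continuousAt
          fun_prop
        have h2 : ContinuousAt (fun s : ℂ => (s - a) ^ (r + 1)) a := by fun_prop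
        exact h1.add (h2.smul hg)
      have hfa : f a = c (r + 1) := by
        have : ∑ j ∈ Finset.Icc 1 r, (a - a) ^ (r + 1 - j) • c j = 0 := by
          apply Finset.sum_eq_zero
          intro j hj
          rw [Finset.mem_Icc] at hj
          rw [sub_self, zero_pow (by omega), zero_smul]
        simp only [f, this]
        simp
      have hz : ∀ᶠ s in 𝓝[≠] a, f s = 0 := by
        filter_upwards [h, self_mem_nhdsWithin] with s hs hsa
        have hne : s - a ≠ 0 := sub_ne_zero.mpr hsa
        have := congrArg (fun x => (s - a) ^ (r + 1) • x) hs
        simp only [smul_zero, smul_add, Finset.smul_sum] at this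
        rw [Finset.sum_Icc_succ_top (by omega)] at this
        rw [← this]
        simp only [f]
        congr 2
        · apply Finset.sum_congr rfl
          intro j hj
          rw [Finset.mem_Icc] at hj
          rw [smul_smul, pow_sub₀ _ hne (by omega)]
        · rw [smul_smul, mul_inv_cancel₀ (pow_ne_zero _ hne), one_smul]
      have t1 : Tendsto f (𝓝[≠] a) (𝓝 (f a)) := hf.tendsto.mono_left nhdsWithin_le_nhds
      have t2 : Tendsto f (𝓝[≠] a) (𝓝 0) :=
        tendsto_const_nhds.congr' (hz.mono fun s hs => hs.symm)
      rw [← hfa]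
      exact tendsto_nhds_unique t1 t2
    intro j hj
    rw [Finset.mem_Icc] at hj
    by_cases hjr : j = r + 1
    · rw [hjr, hc]
    · refine ih ?_ j (Finset.mem_Icc.mpr ⟨hj.1, by omega⟩)
      filter_upwards [h] with s hs
      rw [Finset.sum_Icc_succ_top (by omega), hc, smul_zero, add_zero] at hs
      exact hs

theorem shift_sum {E : Type*} [AddCommGroup E] [Module ℂ E] (z : ℂ) (hz : z ≠ 0)
    (b : ℕ → E) (r : ℕ) (hr : 1 ≤ r) :
    ∑ j ∈ Finset.Icc 1 r, (z * (z ^ j)⁻¹) • b j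
      = b 1 + ∑ j ∈ Finset.Icc 1 r, (z ^ j)⁻¹ • (if j + 1 ≤ r then b (j + 1) else 0) := by
  induction r, hr using Nat.le_induction with
  | base => simp [hz]
  | succ r hr ih =>
    rw [Finset.sum_Icc_succ_top (by omega), ih, Finset.sum_Icc_succ_top (by omega)]
    obtain ⟨q, rfl⟩ : ∃ q, r = q + 1 := ⟨r - 1, by omega⟩
    rw [Finset.sum_Icc_succ_top (by omega), Finset.sum_Icc_succ_top (by omega)]
    have e1 : ∑ j ∈ Finset.Icc 1 q, (z ^ j)⁻¹ • (if j + 1 ≤ q + 1 then b (j + 1) else 0)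
        = ∑ j ∈ Finset.Icc 1 q, (z ^ j)⁻¹ • (if j + 1 ≤ q + 1 + 1 then b (j + 1) else 0) := by
      apply Finset.sum_congr rfl
      intro j hj
      rw [Finset.mem_Icc] at hj
      rw [if_pos (by omega), if_pos (by omega)]
    have e2 : z * (z ^ (q + 1 + 1))⁻¹ = (z ^ (q + 1))⁻¹ := by
      rw [pow_succ z (q + 1)]
      field_simp
    rw [e1, e2]
    simp [add_assoc]

/-- `(A - lam i • I) * B i j = B i (j+1)` for `1 ≤ j ≤ r i - 1`. -/
theorem coefficient_chain
    (n k : ℕ) (hn : 1 ≤ n)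
    (A : Matrix (Fin n) (Fin n) ℂ)
    (lam : Fin k → ℂ) (hlam : Function.Injective lam)
    (r : Fin k → ℕ) (hr : ∀ i, 1 ≤ r i)
    (hsum : ∑ i, r i = n)
    (hchar : A.charpoly = ∏ i, (X - C (lam i)) ^ r i)
    (B : Fin k → ℕ → Matrix (Fin n) (Fin n) ℂ)
    (hB : ∀ s : ℂ, (∀ i, s ≠ lam i) →
      (s • (1 : Matrix (Fin n) (Fin n) ℂ) - A)⁻¹
        = ∑ i, ∑ j ∈ Finset.Icc 1 (r i), ((s - lam i) ^ j)⁻¹ • B i j)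
    :
    ∀ i : Fin k, ∀ j : ℕ, 1 ≤ j → j ≤ r i - 1 →
      (A - lam i • (1 : Matrix (Fin n) (Fin n) ℂ)) * B i j = B i (j + 1) := by
  classical
  intro i j hj1 hj2
  let N : Fin k → Matrix (Fin n) (Fin n) ℂ := fun i => A - lam i • 1
  let c : Fin k → ℕ → Matrix (Fin n) (Fin n) ℂ := fun i j =>
    (if j + 1 ≤ r i then B i (j + 1) else 0) - N i * B i j
  have key : ∀ s : ℂ, (∀ i, s ≠ lam i) →
      ∑ i, ∑ j ∈ Finset.Icc 1 (r i), ((s - lam i) ^ j)⁻¹ • c i j + (∑ i, B i 1 - 1) = 0 := by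
    intro s hs
    have hdet : IsUnit (s • (1 : Matrix (Fin n) (Fin n) ℂ) - A).det := by
      have h1 : (s • (1 : Matrix (Fin n) (Fin n) ℂ) - A).det = A.charpoly.eval s := by
        rw [Matrix.eval_charpoly, Matrix.smul_one_eq_diagonal]
        rfl
      rw [h1, hchar, eval_prod, isUnit_iff_ne_zero, Finset.prod_ne_zero_iff]
      intro i _
      simp only [eval_pow, eval_sub, eval_X, eval_C]
      exact pow_ne_zero _ (sub_ne_zero.mpr (hs i))
    have h1 := Matrix.mul_nonsing_inv _ hdet
    rw [hB s hs, Finset.mul_sum] at h1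
    have h2 : ∀ i, (s • (1 : Matrix (Fin n) (Fin n) ℂ) - A) *
        ∑ j ∈ Finset.Icc 1 (r i), ((s - lam i) ^ j)⁻¹ • B i j
        = B i 1 + ∑ j ∈ Finset.Icc 1 (r i), ((s - lam i) ^ j)⁻¹ • c i j := by
      intro i
      have e : s • (1 : Matrix (Fin n) (Fin n) ℂ) - A = (s - lam i) • 1 - N i := by
        simp only [N, sub_smul]
        abel
      have h3 := shift_sum (s - lam i) (sub_ne_zero.mpr (hs i)) (B i) (r i) (hr i)
      simp only [c, smul_sub, Finset.sum_sub_distrib]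
      rw [← add_sub_assoc, ← h3, e, sub_mul, Finset.mul_sum, Finset.mul_sum]
      simp only [smul_mul_assoc, one_mul, mul_smul_comm, smul_smul, mul_comm (s - lam i)]
    rw [Finset.sum_congr rfl (fun i _ => h2 i), Finset.sum_add_distrib] at h1
    rw [← h1]
    abel
  have hz := polar_part_unique (lam i)
    (fun s => ∑ l ∈ Finset.univ.erase i, ∑ j ∈ Finset.Icc 1 (r l), ((s - lam l) ^ j)⁻¹ • c l j
      + (∑ i, B i 1 - 1)) ?_ (c i) (r i) ?_ j (Finset.mem_Icc.mpr ⟨hj1, by omega⟩)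
  · simp only [c, N] at hz
    rw [if_pos (by omega)] at hz
    exact (sub_eq_zero.mp hz).symm
  · refine ContinuousAt.add ?_ continuousAt_const
    refine tendsto_finsetSum _ fun l hl => tendsto_finsetSum _ fun m _ => ?_
    have hne : lam i - lam l ≠ 0 :=
      sub_ne_zero.mpr fun h => (Finset.ne_of_mem_erase hl) (hlam h).symm
    have h4 : ContinuousAt (fun s : ℂ => ((s - lam l) ^ m)⁻¹) (lam i) :=
      ContinuousAt.inv₀ (by fun_prop) (pow_ne_zero _ hne)
    exact h4.smul continuousAt_const
  · have hev : ∀ᶠ s in nhdsWithin (lam i) {lam i}ᶜ, ∀ l, s ≠ lam l := by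
      rw [Filter.eventually_all]
      intro l
      by_cases hl : l = i
      · subst hl
        exact self_mem_nhdsWithin
      · exact nhdsWithin_le_nhds (isOpen_ne.mem_nhds fun h => hl (hlam h).symm)
    filter_upwards [hev] with s hs
    rw [← add_assoc, Finset.add_sum_erase Finset.univ
      (fun l => ∑ j ∈ Finset.Icc 1 (r l), ((s - lam l) ^ j)⁻¹ • c l j) (Finset.mem_univ i)]
    exact key s hs
end

section
/- For every i with 1 ≤ i ≤ k and every j with 1 ≤ j ≤ r_i, one has B_{i,j} = (A − λ_i I)^{j−1} · B_{i,1}. -/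
open Matrix Polynomial

theorem aux_unique {E : Type*} [AddCommGroup E] [Module ℂ E] [TopologicalSpace E] [T2Space E]
    [ContinuousAdd E] [ContinuousSMul ℂ E] (a : ℂ) (c : ℕ → E) (g : ℂ → E)
    (hg : ContinuousAt g a) (r : ℕ)
    (h : ∀ᶠ s in nhdsWithin a {a}ᶜ, ∑ j ∈ Finset.Icc 1 r, ((s - a) ^ j)⁻¹ • c j = g s) :
    ∀ j, 1 ≤ j → j ≤ r → c j = 0 := by
  induction r with
  | zero => intro j h1 h2; omega
  | succ r ih =>
    have key : c (r + 1) = 0 := by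
      have h1 : ∀ᶠ s in nhdsWithin a {a}ᶜ,
          (∑ j ∈ Finset.Icc 1 r, (s - a) ^ (r + 1 - j) • c j) + c (r + 1)
            = (s - a) ^ (r + 1) • g s := by
        filter_upwards [h, self_mem_nhdsWithin] with s hs hsa
        have hne : s - a ≠ 0 := sub_ne_zero.mpr hsa
        rw [← hs, Finset.sum_Icc_succ_top (by omega), smul_add, smul_smul,
          mul_inv_cancel₀ (pow_ne_zero _ hne), one_smul, Finset.smul_sum]
        congr 1
        refine Finset.sum_congr rfl fun j hj => ?_
        rw [Finset.mem_Icc] at hj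
        rw [smul_smul, pow_sub₀ _ hne (by omega)]
      have hL : Filter.Tendsto (fun s : ℂ =>
          (∑ j ∈ Finset.Icc 1 r, (s - a) ^ (r + 1 - j) • c j) + c (r + 1))
          (nhdsWithin a {a}ᶜ) (nhds (c (r + 1))) := by
        have hc : Continuous (fun s : ℂ =>
          (∑ j ∈ Finset.Icc 1 r, (s - a) ^ (r + 1 - j) • c j) + c (r + 1)) := by fun_prop
        have := (hc.tendsto a).mono_left (nhdsWithin_le_nhds (s := {a}ᶜ))
        convert this using 2
        rw [Finset.sum_eq_zero, zero_add]
        intro j hj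
        rw [Finset.mem_Icc] at hj
        rw [sub_self, zero_pow (by omega), zero_smul]
      have hR : Filter.Tendsto (fun s : ℂ => (s - a) ^ (r + 1) • g s)
          (nhdsWithin a {a}ᶜ) (nhds 0) := by
        have hc : ContinuousAt (fun s : ℂ => (s - a) ^ (r + 1) • g s) a := by
          refine ContinuousAt.smul ?_ hg
          fun_prop
        have := hc.tendsto.mono_left (nhdsWithin_le_nhds (s := {a}ᶜ))
        simpa using this
      exact tendsto_nhds_unique (hL.congr' h1) hR
    intro j hj1 hj2
    rcases Nat.lt_or_ge r j with hlt | hge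
    · obtain rfl : j = r + 1 := by omega
      exact key
    · refine ih ?_ j hj1 hge
      filter_upwards [h] with s hs
      rw [← hs, Finset.sum_Icc_succ_top (by omega), key, smul_zero, add_zero]

theorem aux_tele {n : ℕ} (t : ℂ) (ht : t ≠ 0) (N : Matrix (Fin n) (Fin n) ℂ)
    (B : ℕ → Matrix (Fin n) (Fin n) ℂ) (r : ℕ) :
    ∑ j ∈ Finset.Icc 1 r, (t ^ j)⁻¹ • (t • B j - N * B j)
      = B 1 - (t ^ r)⁻¹ • B (r + 1)
        + ∑ j ∈ Finset.Icc 1 r, (t ^ j)⁻¹ • (B (j + 1) - N * B j) := by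
  induction r with
  | zero => simp
  | succ r ih =>
    rw [Finset.sum_Icc_succ_top (by omega), Finset.sum_Icc_succ_top (by omega), ih]
    have : (t ^ (r + 1))⁻¹ • t • B (r + 1) = (t ^ r)⁻¹ • B (r + 1) := by
      rw [smul_smul]; congr 1; field_simp; ring
    rw [smul_sub, this, smul_sub]
    abel

/-- `B i j = (A - lam i • I)^(j-1) * B i 1` for `1 ≤ j ≤ r i`. -/
theorem coefficient_power_formula
    (n k : ℕ) (hn : 1 ≤ n)
    (A : Matrix (Fin n) (Fin n) ℂ)
    (lam : Fin k → ℂ) (hlam : Function.Injective lam)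
    (r : Fin k → ℕ) (hr : ∀ i, 1 ≤ r i)
    (hsum : ∑ i, r i = n)
    (hchar : A.charpoly = ∏ i, (X - C (lam i)) ^ r i)
    (B : Fin k → ℕ → Matrix (Fin n) (Fin n) ℂ)
    (hB : ∀ s : ℂ, (∀ i, s ≠ lam i) →
      (s • (1 : Matrix (Fin n) (Fin n) ℂ) - A)⁻¹
        = ∑ i, ∑ j ∈ Finset.Icc 1 (r i), ((s - lam i) ^ j)⁻¹ • B i j)
    :
    ∀ i : Fin k, ∀ j : ℕ, 1 ≤ j → j ≤ r i →
      B i j = (A - lam i • (1 : Matrix (Fin n) (Fin n) ℂ)) ^ (j - 1) * B i 1 := by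
  set N : Fin k → Matrix (Fin n) (Fin n) ℂ := fun i => A - lam i • 1 with hN
  let B' : Fin k → ℕ → Matrix (Fin n) (Fin n) ℂ := fun i j => if j ≤ r i then B i j else 0
  have hB' : ∀ i j, j ≤ r i → B' i j = B i j := fun i j h => if_pos h
  have hB0 : ∀ i, B' i (r i + 1) = 0 := fun i => if_neg (by omega)
  have main : ∀ s : ℂ, (∀ i, s ≠ lam i) →
      (1 : Matrix (Fin n) (Fin n) ℂ) = ∑ i, (B i 1 +
        ∑ j ∈ Finset.Icc 1 (r i), ((s - lam i) ^ j)⁻¹ • (B' i (j + 1) - N i * B' i j)) := by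
    intro s hs
    have hdet : IsUnit (s • (1 : Matrix (Fin n) (Fin n) ℂ) - A).det := by
      have h1 : (s • (1 : Matrix (Fin n) (Fin n) ℂ) - A).det = A.charpoly.eval s := by
        rw [Matrix.eval_charpoly, Matrix.smul_one_eq_diagonal]; rfl
      rw [h1, hchar, isUnit_iff_ne_zero, Polynomial.eval_prod, Finset.prod_ne_zero_iff]
      intro i _
      simpa using fun h => absurd (sub_eq_zero.mp h) (hs i)
    rw [← Matrix.mul_nonsing_inv _ hdet, hB s hs, Finset.mul_sum]
    refine Finset.sum_congr rfl fun i _ => ?_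
    have ht := aux_tele (s - lam i) (sub_ne_zero.mpr (hs i)) (N i) (B' i) (r i)
    rw [hB0, smul_zero, sub_zero, hB' i 1 (hr i)] at ht
    rw [← ht, Finset.mul_sum]
    refine Finset.sum_congr rfl fun j hj => ?_
    rw [Finset.mem_Icc] at hj
    rw [hB' i j hj.2, Matrix.mul_smul]
    congr 1
    simp only [hN, Matrix.sub_mul, Matrix.smul_mul, Matrix.one_mul, sub_smul]
    abel
  have step : ∀ i j, 1 ≤ j → j ≤ r i → B' i (j + 1) - N i * B' i j = 0 := by
    intro i
    refine aux_unique (lam i) (fun j => B' i (j + 1) - N i * B' i j)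
      (fun s => 1 - B i 1 - ∑ l ∈ Finset.univ.erase i, (B l 1 +
        ∑ j ∈ Finset.Icc 1 (r l), ((s - lam l) ^ j)⁻¹ • (B' l (j + 1) - N l * B' l j)))
      ?_ (r i) ?_
    · refine continuousAt_const.sub (tendsto_finsetSum _ fun l hl => ?_)
      refine tendsto_const_nhds.add (tendsto_finsetSum _ fun j hj => ?_)
      refine Filter.Tendsto.smul ?_ tendsto_const_nhds
      have hne : lam i - lam l ≠ 0 :=
        sub_ne_zero.mpr fun h => (Finset.ne_of_mem_erase hl) (hlam h).symm
      have : ContinuousAt (fun s : ℂ => (s - lam l) ^ j) (lam i) := by fun_prop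
      exact this.inv₀ (pow_ne_zero _ hne)
    · have hev : ∀ᶠ s in nhdsWithin (lam i) {lam i}ᶜ, ∀ l, s ≠ lam l := by
        rw [Filter.eventually_all]
        intro l
        by_cases h : l = i
        · subst h; exact self_mem_nhdsWithin
        · exact nhdsWithin_le_nhds (isOpen_ne.mem_nhds fun h' => h (hlam h').symm)
      filter_upwards [hev] with s hs
      have := main s hs
      rw [← Finset.add_sum_erase _ _ (Finset.mem_univ i)] at this
      nth_rewrite 1 [this]
      abel
  intro i j hj
  induction j, hj using Nat.le_induction with
  | base => intro _; simp
  | succ j hj ih =>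
    intro hjr
    have h := step i j hj (by omega)
    rw [hB' i _ hjr, hB' i j (by omega), sub_eq_zero] at h
    obtain ⟨m, rfl⟩ : ∃ m, j = m + 1 := ⟨j - 1, by omega⟩
    rw [h, ih (by omega), ← Matrix.mul_assoc]
    simp only [Nat.add_sub_cancel]
    rw [pow_succ']
end

section
/- For every i with 1 ≤ i ≤ k and every j with 1 ≤ j ≤ r_i, one has (A − λ_i I)^{r_i + 1 − j} · B_{i,j} = 0. Consequently, every nonzero column b of B_{i,j} is a generalized eigenvector of A corresponding to λ_i of rank at most r_i + 1 − j, i.e., (A − λ_i I)^{r_i+1−j} b = 0 and b ≠ 0. -/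
open Matrix Polynomial

open Filter Topology in
lemma pf_unique {k : ℕ} (lam : Fin k → ℂ) (hlam : Function.Injective lam) (r : Fin k → ℕ)
    (c : Fin k → ℕ → ℂ) (d : ℂ)
    (h : ∀ s : ℂ, (∀ i, s ≠ lam i) →
      ∑ i, ∑ j ∈ Finset.Icc 1 (r i), ((s - lam i) ^ j)⁻¹ * c i j = d) (i : Fin k) :
    ∀ m j : ℕ, r i - j = m → 1 ≤ j → j ≤ r i → c i j = 0 := by
  intro m
  induction m using Nat.strong_induction_on with
  | _ m ih =>
  intro j hm hj1 hjr
  have hbig : ∀ j', j < j' → j' ≤ r i → c i j' = 0 := fun j' h1 h2 =>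
    ih (r i - j') (by omega) j' rfl (by omega) h2
  have hz : Tendsto (fun s : ℂ => s - lam i) (𝓝[≠] (lam i)) (𝓝 0) := by
    have : ContinuousAt (fun s : ℂ => s - lam i) (lam i) := by fun_prop
    have h2 := this.tendsto
    simp only [sub_self] at h2
    exact h2.mono_left nhdsWithin_le_nhds
  have hzp : ∀ p : ℕ, 1 ≤ p → Tendsto (fun s : ℂ => (s - lam i) ^ p) (𝓝[≠] (lam i)) (𝓝 0) := by
    intro p hp
    have := hz.pow p
    rwa [zero_pow (by omega)] at this
  have hne : ∀ᶠ s in 𝓝[≠] (lam i), s ≠ lam i := eventually_mem_nhdsWithin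
  have hev : ∀ᶠ s in 𝓝[≠] (lam i), ∀ i', s ≠ lam i' := by
    rw [eventually_all]
    intro i'
    by_cases hi : i' = i
    · rw [hi]; exact hne
    · have : lam i ≠ lam i' := fun e => hi (hlam e).symm
      exact (eventually_ne_nhds this).filter_mono nhdsWithin_le_nhds
  have hterm : ∀ i' : Fin k, ∀ j' ∈ Finset.Icc 1 (r i'),
      Tendsto (fun s : ℂ => (s - lam i) ^ j * (((s - lam i') ^ j')⁻¹ * c i' j')) (𝓝[≠] (lam i))
        (𝓝 (if i' = i then (if j' = j then c i j else 0) else 0)) := by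
    intro i' j' hj'
    rw [Finset.mem_Icc] at hj'
    by_cases hi : i' = i
    · subst hi
      rw [if_pos rfl]
      rcases lt_trichotomy j' j with hlt | heq | hgt
      · rw [if_neg (by omega)]
        have h1 := (hzp (j - j') (by omega)).mul_const (c i' j')
        rw [zero_mul] at h1
        refine h1.congr' ?_
        filter_upwards [hne] with s hs
        have hs' : s - lam i' ≠ 0 := sub_ne_zero.mpr hs
        rw [← mul_assoc, pow_sub₀ _ hs' hlt.le]
      · subst heq
        rw [if_pos rfl]
        refine tendsto_const_nhds.congr' ?_
        filter_upwards [hne] with s hs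
        have hs' : s - lam i' ≠ 0 := sub_ne_zero.mpr hs
        rw [← mul_assoc, mul_inv_cancel₀ (pow_ne_zero _ hs'), one_mul]
      · rw [if_neg (by omega), hbig j' hgt hj'.2]
        simp
    · rw [if_neg hi]
      have hl : lam i - lam i' ≠ 0 := sub_ne_zero.mpr fun e => hi (hlam e).symm
      have h1 : ContinuousAt (fun s : ℂ => ((s - lam i') ^ j')⁻¹ * c i' j') (lam i) := by
        refine ContinuousAt.mul (ContinuousAt.inv₀ (by fun_prop) (pow_ne_zero _ hl))
          continuousAt_const
      have h2 := (hzp j hj1).mul (h1.tendsto.mono_left (nhdsWithin_le_nhds (s := {lam i}ᶜ)))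
      rwa [zero_mul] at h2
  have hL := tendsto_finsetSum Finset.univ
    (fun i' _ => tendsto_finsetSum (Finset.Icc 1 (r i')) (hterm i'))
  have hR := (hzp j hj1).mul_const d
  rw [zero_mul] at hR
  have hL' := hL.congr' (f₂ := fun s => (s - lam i) ^ j * d) (by
    filter_upwards [hev] with s hs
    rw [← h s hs, Finset.mul_sum]
    simp only [Finset.mul_sum])
  have := tendsto_nhds_unique hL' hR
  have h3 : ∀ i' : Fin k, (∑ j' ∈ Finset.Icc 1 (r i'),
      if i' = i then (if j' = j then c i j else 0) else 0) = if i' = i then c i j else 0 := by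
    intro i'
    by_cases hi : i' = i
    · subst hi
      simp [hj1, hjr]
    · simp [hi]
  simp only [h3] at this
  simpa using this

lemma shift_sum_s6 (t : ℂ) (ht : t ≠ 0) (b : ℕ → ℂ) (r : ℕ) :
    ∑ j ∈ Finset.Icc 1 r, (t ^ j)⁻¹ * b (j + 1)
      = ∑ j ∈ Finset.Icc 1 r, t * ((t ^ j)⁻¹ * b j) - b 1 + (t ^ r)⁻¹ * b (r + 1) := by
  induction r with
  | zero => simp
  | succ r ih =>
    rw [Finset.sum_Icc_succ_top (by omega), Finset.sum_Icc_succ_top (by omega), ih]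
    have : t * ((t ^ (r + 1))⁻¹ * b (r + 1)) = (t ^ r)⁻¹ * b (r + 1) := by
      rw [pow_succ]; field_simp
    rw [this]; ring

/-- `(A - lam i • I)^(r i + 1 - j) * B i j = 0`, and every nonzero column of `B i j` is a generalized eigenvector of rank at most `r i + 1 - j`. -/
theorem generalized_eigenvector_columns
    (n k : ℕ) (hn : 1 ≤ n)
    (A : Matrix (Fin n) (Fin n) ℂ)
    (lam : Fin k → ℂ) (hlam : Function.Injective lam)
    (r : Fin k → ℕ) (hr : ∀ i, 1 ≤ r i)
    (hsum : ∑ i, r i = n)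
    (hchar : A.charpoly = ∏ i, (X - C (lam i)) ^ r i)
    (B : Fin k → ℕ → Matrix (Fin n) (Fin n) ℂ)
    (hB : ∀ s : ℂ, (∀ i, s ≠ lam i) →
      (s • (1 : Matrix (Fin n) (Fin n) ℂ) - A)⁻¹
        = ∑ i, ∑ j ∈ Finset.Icc 1 (r i), ((s - lam i) ^ j)⁻¹ • B i j)
    :
    ∀ i : Fin k, ∀ j : ℕ, 1 ≤ j → j ≤ r i →
      (A - lam i • (1 : Matrix (Fin n) (Fin n) ℂ)) ^ (r i + 1 - j) * B i j = 0 ∧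
        ∀ m : Fin n, (fun p => B i j p m) ≠ 0 →
          ((A - lam i • (1 : Matrix (Fin n) (Fin n) ℂ)) ^ (r i + 1 - j)).mulVec
              (fun p => B i j p m) = 0 ∧ (fun p => B i j p m) ≠ 0 := by
  have hinv : ∀ s : ℂ, (∀ i, s ≠ lam i) →
      (s • (1 : Matrix (Fin n) (Fin n) ℂ) - A) * (s • (1 : Matrix (Fin n) (Fin n) ℂ) - A)⁻¹ = 1 := by
    intro s hs
    apply Matrix.mul_nonsing_inv
    rw [isUnit_iff_ne_zero]
    have h1 : A.charpoly.eval s = (s • (1 : Matrix (Fin n) (Fin n) ℂ) - A).det := by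
      rw [Matrix.eval_charpoly, Matrix.smul_one_eq_diagonal]
      rfl
    rw [← h1, hchar, Polynomial.eval_prod]
    refine Finset.prod_ne_zero_iff.mpr fun i _ => ?_
    simp only [eval_pow, eval_sub, eval_X, eval_C]
    exact pow_ne_zero _ (sub_ne_zero.mpr (hs i))
  let B' : Fin k → ℕ → Matrix (Fin n) (Fin n) ℂ := fun i j => if j ≤ r i then B i j else 0
  have hB'0 : ∀ i, B' i (r i + 1) = 0 := fun i => by simp [B']
  have hB' : ∀ i j, j ≤ r i → B' i j = B i j := fun i j h => by simp [B', h]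
  have key : ∀ i j, 1 ≤ j → j ≤ r i →
      (A - lam i • (1 : Matrix (Fin n) (Fin n) ℂ)) * B' i j = B' i (j + 1) := by
    intro i j h1 h2
    ext p q
    have := pf_unique lam hlam r
      (fun i j => B' i (j + 1) p q - ((A - lam i • (1 : Matrix (Fin n) (Fin n) ℂ)) * B' i j) p q)
      ((1 : Matrix (Fin n) (Fin n) ℂ) p q - ∑ i, B' i 1 p q) ?_ i _ j rfl h1 h2
    · exact (sub_eq_zero.mp this).symm
    intro s hs
    have e := hinv s hs
    rw [hB s hs, Finset.mul_sum] at e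
    have e' := congrFun (congrFun e p) q
    rw [← e', Matrix.sum_apply, ← Finset.sum_sub_distrib]
    refine Finset.sum_congr rfl fun i _ => ?_
    have ht : s - lam i ≠ 0 := sub_ne_zero.mpr (hs i)
    simp only [mul_sub, Finset.sum_sub_distrib]
    rw [shift_sum_s6 _ ht (fun j => B' i j p q) (r i), hB'0, Finset.mul_sum, Matrix.sum_apply]
    have : ∀ j ∈ Finset.Icc 1 (r i),
        ((s • (1 : Matrix (Fin n) (Fin n) ℂ) - A) * (((s - lam i) ^ j)⁻¹ • B i j)) p q
        = (s - lam i) * (((s - lam i) ^ j)⁻¹ * B' i j p q)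
          - ((s - lam i) ^ j)⁻¹ * ((A - lam i • (1 : Matrix (Fin n) (Fin n) ℂ)) * B' i j) p q := by
      intro j hj
      rw [hB' i j (Finset.mem_Icc.mp hj).2]
      simp only [sub_mul, smul_mul_assoc, one_mul, Matrix.mul_smul, Matrix.sub_apply,
        Matrix.smul_apply, smul_eq_mul]
      ring
    rw [Finset.sum_congr rfl this, Finset.sum_sub_distrib]
    simp
    ring
  have main : ∀ i : Fin k, ∀ m j : ℕ, 1 ≤ j → j + m = r i + 1 →
      (A - lam i • (1 : Matrix (Fin n) (Fin n) ℂ)) ^ m * B' i j = 0 := by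
    intro i m
    induction m with
    | zero =>
      intro j _ h
      have : j = r i + 1 := by omega
      rw [this, hB'0, mul_zero]
    | succ m ih =>
      intro j h1 h
      rw [pow_succ, mul_assoc, key i j h1 (by omega)]
      exact ih (j + 1) (by omega) (by omega)
  intro i j h1 h2
  have h0 := main i (r i + 1 - j) j h1 (by omega)
  rw [hB' i j h2] at h0
  refine ⟨h0, fun m hm => ⟨?_, hm⟩⟩
  ext p
  exact congrFun (congrFun h0 p) m
end

section
/- For every i with 1 ≤ i ≤ k and every vector v ∈ ℂⁿ lying in the generalized eigenspace of A for λ_i (i.e., (A − λ_i I)^{r_i} v = 0), one has B_{i,1} v = v. -/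
open Matrix Polynomial

/-- The residue at `lam i0` of a vanishing partial fraction is zero. -/
theorem residue_eq_zero_of_partial_fraction
    (k : ℕ) (lam : Fin k → ℂ) (hlam : Function.Injective lam)
    (r : Fin k → ℕ) (hr : ∀ i, 1 ≤ r i) (d : Fin k → ℕ → ℂ)
    (h : ∀ s : ℂ, (∀ i, s ≠ lam i) →
      ∑ i, ∑ j ∈ Finset.Icc 1 (r i), ((s - lam i) ^ j)⁻¹ * d i j = 0) (i0 : Fin k) :
    d i0 1 = 0 := by
  obtain ⟨R, hR, hball⟩ : ∃ R > 0, ∀ i, i ≠ i0 → lam i ∉ Metric.closedBall (lam i0) R := by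
    have hfin : (Set.image lam {i | i ≠ i0}).Finite := Set.toFinite _
    have hmem : (Set.image lam {i | i ≠ i0})ᶜ ∈ nhds (lam i0) := by
      apply hfin.isClosed.isOpen_compl.mem_nhds
      rintro ⟨i, hi, he⟩
      exact hi (hlam he)
    obtain ⟨R, hR, hs⟩ := Metric.nhds_basis_closedBall.mem_iff.1 hmem
    exact ⟨R, hR, fun i hi hm => hs hm ⟨i, hi, rfl⟩⟩
  have hne : ∀ s ∈ Metric.sphere (lam i0) R, ∀ i, s ≠ lam i := by
    rintro s hs i rfl
    by_cases hi : i = i0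
    · subst hi
      simp at hs
      exact hR.ne hs
    · exact hball i hi (Metric.sphere_subset_closedBall hs)
  have hint : ∀ i j, CircleIntegrable (fun s => ((s - lam i) ^ j)⁻¹ * d i j) (lam i0) R := by
    intro i j
    apply ContinuousOn.circleIntegrable hR.le
    apply ContinuousOn.mul _ continuousOn_const
    apply ContinuousOn.inv₀ (by fun_prop)
    intro s hs
    exact pow_ne_zero _ (sub_ne_zero.2 (hne s hs i))
  have h0 : (∮ s in C(lam i0, R),
      ∑ i, ∑ j ∈ Finset.Icc 1 (r i), ((s - lam i) ^ j)⁻¹ * d i j) = 0 := by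
    rw [circleIntegral.integral_congr (g := fun _ => 0) hR.le (fun s hs => h s (hne s hs))]
    simp [circleIntegral]
  rw [circleIntegral.integral_fun_sum
    (fun i _ => CircleIntegrable.fun_sum _ (fun j _ => hint i j))] at h0
  simp_rw [circleIntegral.integral_fun_sum (fun j _ => hint _ j)] at h0
  rw [Finset.sum_eq_single i0, Finset.sum_eq_single 1] at h0
  · have h1 : (∮ s in C(lam i0, R), ((s - lam i0) ^ 1)⁻¹ * d i0 1)
        = (2 * Real.pi * Complex.I) * d i0 1 := by
      simp_rw [pow_one, mul_comm _ (d i0 1)]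
      rw [circleIntegral.integral_const_mul, circleIntegral.integral_sub_center_inv _ (ne_of_gt hR)]
    rw [h1] at h0
    exact (mul_eq_zero.1 h0).resolve_left Complex.two_pi_I_ne_zero
  · intro j _ hj
    simp_rw [mul_comm _ (d i0 j)]
    rw [circleIntegral.integral_const_mul]
    have := circleIntegral.integral_sub_zpow_of_ne (n := -(j : ℤ)) (by omega) (lam i0) (lam i0) R
    simp only [_root_.zpow_neg, _root_.zpow_natCast] at this
    rw [this, mul_zero]
  · intro h1
    exact absurd (Finset.mem_Icc.2 ⟨le_rfl, hr i0⟩) h1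
  · intro i _ hi
    apply Finset.sum_eq_zero
    intro j _
    apply Complex.circleIntegral_eq_zero_of_differentiable_on_off_countable hR.le
      Set.countable_empty
    · apply ContinuousOn.mul _ continuousOn_const
      apply ContinuousOn.inv₀ (by fun_prop)
      intro s hs
      refine pow_ne_zero _ (sub_ne_zero.2 ?_)
      rintro rfl
      exact hball i hi hs
    · intro s hs
      have : (s - lam i) ^ j ≠ 0 := by
        refine pow_ne_zero _ (sub_ne_zero.2 ?_)
        rintro rfl
        exact hball i hi (Metric.ball_subset_closedBall hs.1)
      apply DifferentiableAt.mul_const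
      exact DifferentiableAt.inv (by fun_prop) this
  · intro h1
    exact absurd (Finset.mem_univ _) h1

theorem resolvent_geom (n : ℕ) (N : Matrix (Fin n) (Fin n) ℂ) (t : ℂ) (ht : t ≠ 0) (m : ℕ) :
    (t • (1 : Matrix (Fin n) (Fin n) ℂ) - N) *
      ∑ j ∈ Finset.Icc 1 m, (t ^ j)⁻¹ • N ^ (j - 1) = 1 - (t ^ m)⁻¹ • N ^ m := by
  induction m with
  | zero => simp
  | succ m ih =>
    rw [Finset.sum_Icc_succ_top (by omega), mul_add, ih, Nat.add_sub_cancel, sub_mul,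
      smul_mul_assoc, one_mul, smul_smul, mul_smul_comm, ← pow_succ']
    have : t * (t ^ (m + 1))⁻¹ = (t ^ m)⁻¹ := by
      rw [pow_succ]; field_simp
    rw [this]
    abel

/-- `B i 1` acts as the identity on the generalized eigenspace of `A` for `lam i`. -/
theorem projector_identity_on_generalized_eigenspace
    (n k : ℕ) (hn : 1 ≤ n)
    (A : Matrix (Fin n) (Fin n) ℂ)
    (lam : Fin k → ℂ) (hlam : Function.Injective lam)
    (r : Fin k → ℕ) (hr : ∀ i, 1 ≤ r i)
    (hsum : ∑ i, r i = n)
    (hchar : A.charpoly = ∏ i, (X - C (lam i)) ^ r i)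
    (B : Fin k → ℕ → Matrix (Fin n) (Fin n) ℂ)
    (hB : ∀ s : ℂ, (∀ i, s ≠ lam i) →
      (s • (1 : Matrix (Fin n) (Fin n) ℂ) - A)⁻¹
        = ∑ i, ∑ j ∈ Finset.Icc 1 (r i), ((s - lam i) ^ j)⁻¹ • B i j)
    :
    ∀ i : Fin k, ∀ v : Fin n → ℂ,
      ((A - lam i • (1 : Matrix (Fin n) (Fin n) ℂ)) ^ r i).mulVec v = 0 →
        (B i 1).mulVec v = v := by
  intro i0 v hv
  set N := A - lam i0 • (1 : Matrix (Fin n) (Fin n) ℂ) with hN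
  funext a
  have key := residue_eq_zero_of_partial_fraction k lam hlam r hr
    (fun i j => (B i j).mulVec v a - if i = i0 then (N ^ (j - 1)).mulVec v a else 0) ?_ i0
  · simpa [sub_eq_zero] using key
  intro s hs
  have hdet : IsUnit (s • (1 : Matrix (Fin n) (Fin n) ℂ) - A).det := by
    have h1 : (s • (1 : Matrix (Fin n) (Fin n) ℂ) - A).det = A.charpoly.eval s := by
      rw [Matrix.eval_charpoly, Matrix.scalar_apply, Matrix.smul_one_eq_diagonal]
    rw [h1, hchar, Polynomial.eval_prod, isUnit_iff_ne_zero, Finset.prod_ne_zero_iff]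
    intro i _
    simpa using fun h => absurd h (sub_ne_zero.2 (hs i))
  have hg := resolvent_geom n N (s - lam i0) (sub_ne_zero.2 (hs i0)) (r i0)
  have hsN : (s - lam i0) • (1 : Matrix (Fin n) (Fin n) ℂ) - N = s • 1 - A := by
    rw [hN, sub_smul]; abel
  rw [hsN] at hg
  have hres : (s • (1 : Matrix (Fin n) (Fin n) ℂ) - A)⁻¹.mulVec v =
      (∑ j ∈ Finset.Icc 1 (r i0), ((s - lam i0) ^ j)⁻¹ • N ^ (j - 1)).mulVec v := by
    have h2 := congrArg (fun M => (s • (1 : Matrix (Fin n) (Fin n) ℂ) - A)⁻¹.mulVec (M.mulVec v)) hg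
    simp only [Matrix.sub_mulVec, Matrix.smul_mulVec, hv, smul_zero, sub_zero,
      Matrix.one_mulVec] at h2
    rw [← h2, Matrix.mulVec_mulVec, ← mul_assoc, Matrix.nonsing_inv_mul _ hdet, one_mul]
  rw [hB s hs] at hres
  have h3 := congrFun hres a
  simp only [Matrix.sum_mulVec, Matrix.smul_mulVec, Finset.sum_apply, Pi.smul_apply,
    smul_eq_mul] at h3
  simp only [mul_sub, Finset.sum_sub_distrib]
  rw [h3, sub_eq_zero, Finset.sum_eq_single i0]
  · simp
  · intro i _ hi
    simp [hi]
  · simp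
end

section
/- For all indices i ≠ p with 1 ≤ i, p ≤ k and every vector v ∈ ℂⁿ lying in the generalized eigenspace of A for λ_p (i.e., (A − λ_p I)^{r_p} v = 0), one has B_{i,1} v = 0. -/
open Matrix Polynomial

open Filter Topology in
lemma polar_part_zero {E : Type*} [NormedAddCommGroup E] [NormedSpace ℂ E] (a : ℂ) (c : ℕ → E)
    (L : E) : ∀ r : ℕ,
    Tendsto (fun s : ℂ => ∑ j ∈ Finset.Icc 1 r, ((s - a) ^ j)⁻¹ • c j) (𝓝[≠] a) (𝓝 L) →
    ∀ j ∈ Finset.Icc 1 r, c j = 0 := by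
  intro r
  induction r with
  | zero => intro _ j hj; simp at hj
  | succ r ih =>
    intro h
    have ht : Tendsto (fun s : ℂ => (s - a) ^ (r + 1)) (𝓝[≠] a) (𝓝 0) := by
      have : ContinuousAt (fun s : ℂ => (s - a) ^ (r + 1)) a := by fun_prop
      have h2 := this.tendsto
      simp only [sub_self, ne_eq, Nat.add_eq_zero_iff, one_ne_zero, and_false,
        not_false_eq_true, zero_pow] at h2
      exact h2.mono_left nhdsWithin_le_nhds
    have h1 := ht.smul h
    rw [zero_smul] at h1
    have h2 : Tendsto (fun s : ℂ => (∑ j ∈ Finset.Icc 1 r, (s - a) ^ (r + 1 - j) • c j)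
        + c (r + 1)) (𝓝[≠] a) (𝓝 (c (r + 1))) := by
      have hc : ContinuousAt (fun s : ℂ => (∑ j ∈ Finset.Icc 1 r, (s - a) ^ (r + 1 - j) • c j)
        + c (r + 1)) a := by fun_prop
      have h3 := hc.tendsto
      have hz : ∑ j ∈ Finset.Icc 1 r, (a - a) ^ (r + 1 - j) • c j = 0 := by
        apply Finset.sum_eq_zero
        intro j hj
        rw [Finset.mem_Icc] at hj
        rw [sub_self, zero_pow (by omega), zero_smul]
      rw [hz, zero_add] at h3
      exact h3.mono_left nhdsWithin_le_nhds
    have hlast : c (r + 1) = 0 := by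
      refine tendsto_nhds_unique h2 (h1.congr' ?_)
      filter_upwards [self_mem_nhdsWithin] with s hs
      have hs' : s - a ≠ 0 := sub_ne_zero.mpr hs
      rw [Finset.sum_Icc_succ_top (by omega), smul_add, Finset.smul_sum, smul_smul,
        mul_inv_cancel₀ (pow_ne_zero _ hs'), one_smul]
      congr 1
      apply Finset.sum_congr rfl
      intro j hj
      rw [Finset.mem_Icc] at hj
      rw [smul_smul, pow_sub₀ _ hs' (by omega)]
    intro j hj
    rw [Finset.mem_Icc] at hj
    rcases Nat.lt_or_ge r j with hlt | hle
    · obtain rfl : j = r + 1 := by omega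
      exact hlast
    · refine ih (h.congr fun s => ?_) j (Finset.mem_Icc.mpr ⟨hj.1, hle⟩)
      rw [Finset.sum_Icc_succ_top (by omega), hlast, smul_zero, add_zero]

lemma resolvent_apply {n : ℕ} (A : Matrix (Fin n) (Fin n) ℂ) (a s : ℂ) (hs : s ≠ a)
    (hdet : IsUnit (s • (1 : Matrix (Fin n) (Fin n) ℂ) - A).det) (r : ℕ) (v : Fin n → ℂ)
    (hv : ((A - a • (1 : Matrix (Fin n) (Fin n) ℂ)) ^ r).mulVec v = 0) :
    (s • (1 : Matrix (Fin n) (Fin n) ℂ) - A)⁻¹.mulVec v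
      = ∑ m ∈ Finset.range r, ((s - a) ^ (m + 1))⁻¹ •
        ((A - a • (1 : Matrix (Fin n) (Fin n) ℂ)) ^ m).mulVec v := by
  have hs' : s - a ≠ 0 := sub_ne_zero.mpr hs
  set N := A - a • (1 : Matrix (Fin n) (Fin n) ℂ) with hN
  have hA : s • (1 : Matrix (Fin n) (Fin n) ℂ) - A = (s - a) • 1 - N := by
    rw [hN, sub_smul]; abel
  have key : (s • (1 : Matrix (Fin n) (Fin n) ℂ) - A).mulVec
      (∑ m ∈ Finset.range r, ((s - a) ^ (m + 1))⁻¹ • (N ^ m).mulVec v) = v := by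
    rw [Matrix.mulVec_sum]
    have : ∀ m ∈ Finset.range r, (s • (1 : Matrix (Fin n) (Fin n) ℂ) - A).mulVec
        (((s - a) ^ (m + 1))⁻¹ • (N ^ m).mulVec v) =
        ((s - a) ^ m)⁻¹ • (N ^ m).mulVec v - ((s - a) ^ (m+1))⁻¹ • (N ^ (m+1)).mulVec v := by
      intro m _
      rw [hA, Matrix.mulVec_smul, Matrix.sub_mulVec, Matrix.smul_mulVec, Matrix.one_mulVec,
        Matrix.mulVec_mulVec, ← pow_succ', smul_sub, smul_smul]
      congr 2
      field_simp
      ring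
    rw [Finset.sum_congr rfl this,
      Finset.sum_range_sub' (fun m => ((s - a) ^ m)⁻¹ • (N ^ m).mulVec v), hv]
    simp
  conv_lhs => rw [← key]
  rw [Matrix.mulVec_mulVec, Matrix.nonsing_inv_mul _ hdet, Matrix.one_mulVec]

/-- `B i 1` annihilates the generalized eigenspace of `A` for `lam p` when `i ≠ p`. -/
theorem projector_vanishes_on_other_generalized_eigenspaces
    (n k : ℕ) (hn : 1 ≤ n)
    (A : Matrix (Fin n) (Fin n) ℂ)
    (lam : Fin k → ℂ) (hlam : Function.Injective lam)
    (r : Fin k → ℕ) (hr : ∀ i, 1 ≤ r i)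
    (hsum : ∑ i, r i = n)
    (hchar : A.charpoly = ∏ i, (X - C (lam i)) ^ r i)
    (B : Fin k → ℕ → Matrix (Fin n) (Fin n) ℂ)
    (hB : ∀ s : ℂ, (∀ i, s ≠ lam i) →
      (s • (1 : Matrix (Fin n) (Fin n) ℂ) - A)⁻¹
        = ∑ i, ∑ j ∈ Finset.Icc 1 (r i), ((s - lam i) ^ j)⁻¹ • B i j)
    :
    ∀ i p : Fin k, i ≠ p → ∀ v : Fin n → ℂ,
      ((A - lam p • (1 : Matrix (Fin n) (Fin n) ℂ)) ^ r p).mulVec v = 0 →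
        (B i 1).mulVec v = 0 := by
  intro i p hip v hv
  have hne : lam i ≠ lam p := fun h => hip (hlam h)
  set N := A - lam p • (1 : Matrix (Fin n) (Fin n) ℂ) with hN
  let g : ℂ → (Fin n → ℂ) := fun s =>
    (∑ m ∈ Finset.range (r p), ((s - lam p) ^ (m + 1))⁻¹ • (N ^ m).mulVec v)
      - ∑ l ∈ Finset.univ.erase i, ∑ j ∈ Finset.Icc 1 (r l),
          ((s - lam l) ^ j)⁻¹ • (B l j).mulVec v
  have hg : ContinuousAt g (lam i) := by
    have hc : ∀ (b : ℂ) (j : ℕ) (w : Fin n → ℂ), lam i ≠ b →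
        ContinuousAt (fun s : ℂ => ((s - b) ^ j)⁻¹ • w) (lam i) := by
      intro b j w hb
      have h0 : ContinuousAt (fun s : ℂ => (s - b) ^ j) (lam i) := by fun_prop
      exact (h0.inv₀ (pow_ne_zero _ (sub_ne_zero.mpr hb))).smul continuousAt_const
    refine ContinuousAt.sub ?_ ?_
    · exact tendsto_finsetSum _ fun m _ => hc _ _ _ hne
    · refine tendsto_finsetSum _ fun l hl => tendsto_finsetSum _ fun j _ => hc _ _ _ ?_
      intro h
      exact (Finset.ne_of_mem_erase hl) (hlam h).symm
  refine polar_part_zero (lam i) (fun j => (B i j).mulVec v) (g (lam i)) (r i) ?_ 1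
    (Finset.mem_Icc.mpr ⟨le_rfl, hr i⟩)
  refine (hg.tendsto.mono_left nhdsWithin_le_nhds).congr' ?_
  have hev : ∀ᶠ s in nhdsWithin (lam i) {lam i}ᶜ, ∀ l, s ≠ lam l := by
    rw [Filter.eventually_all]
    intro l
    by_cases h : l = i
    · subst h
      exact self_mem_nhdsWithin
    · exact nhdsWithin_le_nhds (isOpen_ne.mem_nhds fun h' => h (hlam h').symm)
  filter_upwards [hev] with s hs
  have hdet : IsUnit (s • (1 : Matrix (Fin n) (Fin n) ℂ) - A).det := by
    have h1 := Matrix.eval_charpoly A s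
    rw [Matrix.smul_one_eq_diagonal, ← Matrix.scalar_apply, ← h1, hchar, isUnit_iff_ne_zero,
      Polynomial.eval_prod, Finset.prod_ne_zero_iff]
    intro l _
    simpa using fun h => absurd h (sub_ne_zero.mpr (hs l))
  have h1 := resolvent_apply A (lam p) s (hs p) hdet (r p) v hv
  rw [hB s hs, Matrix.sum_mulVec] at h1
  simp only [Matrix.sum_mulVec, Matrix.smul_mulVec] at h1
  simp only [g]
  rw [hN, ← h1, ← Finset.add_sum_erase _ _ (Finset.mem_univ i), add_sub_cancel_right]
end

section
/- For every i with 1 ≤ i ≤ k, the column space (range) of the matrix B_{i,1} equals the generalized eigenspace of A for λ_i, i.e., {B_{i,1} x : x ∈ ℂⁿ} = {v ∈ ℂⁿ : (A − λ_i I)^{r_i} v = 0}. -/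
open Matrix Polynomial

/-- Local uniqueness of the principal part of a Laurent expansion. -/
lemma principal_part_zero {E : Type*} [AddCommGroup E] [Module ℂ E] [TopologicalSpace E]
    [IsTopologicalAddGroup E] [ContinuousSMul ℂ E] [T2Space E] (a : ℂ) (c : ℕ → E) (g : ℂ → E)
    (hg : ContinuousAt g a) (R : ℕ)
    (h : ∀ᶠ s in nhdsWithin a {a}ᶜ,
      ∑ j ∈ Finset.range R, ((s - a) ^ (j + 1))⁻¹ • c j + g s = 0) :
    ∀ j < R, c j = 0 := by
  induction R with
  | zero => intro j hj; omega
  | succ m ih =>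
    have hm : c m = 0 := by
      set f : ℂ → E := fun s => ∑ j ∈ Finset.range m, (s - a) ^ (m - j) • c j + c m
        + (s - a) ^ (m + 1) • g s with hf
      have hc : ContinuousAt f a := by
        have h1 : Continuous fun s : ℂ => ∑ j ∈ Finset.range m, (s - a) ^ (m - j) • c j + c m := by
          fun_prop
        have h2 : ContinuousAt (fun s : ℂ => (s - a) ^ (m + 1)) a := by fun_prop
        exact h1.continuousAt.add (h2.smul hg)
      have h0 : f a = c m := by
        have : ∑ j ∈ Finset.range m, (a - a) ^ (m - j) • c j = 0 := by
          apply Finset.sum_eq_zero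
          intro j hj
          have := Finset.mem_range.1 hj
          rw [sub_self, zero_pow (by omega), zero_smul]
        simp only [hf, this]
        simp
      have hz : f =ᶠ[nhdsWithin a {a}ᶜ] fun _ => 0 := by
        filter_upwards [h, self_mem_nhdsWithin] with s hs hsa
        have hne : s - a ≠ 0 := sub_ne_zero.2 hsa
        have := congrArg (fun x => (s - a) ^ (m + 1) • x) hs
        simp only [smul_zero, smul_add, Finset.smul_sum, Finset.sum_range_succ, smul_smul] at this
        rw [mul_inv_cancel₀ (pow_ne_zero _ hne), one_smul] at this
        rw [← this]
        simp only [hf]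
        congr 2
        apply Finset.sum_congr rfl
        intro j hj
        have := Finset.mem_range.1 hj
        congr 1
        rw [eq_mul_inv_iff_mul_eq₀ (pow_ne_zero _ hne), ← pow_add]
        congr 1
        omega
      have ht : Filter.Tendsto f (nhdsWithin a {a}ᶜ) (nhds (c m)) := by
        rw [← h0]; exact hc.tendsto.mono_left nhdsWithin_le_nhds
      exact tendsto_nhds_unique (ht.congr' hz) tendsto_const_nhds
    intro j hj
    rcases Nat.lt_succ_iff_lt_or_eq.1 hj with hj | rfl
    · refine ih ?_ j hj
      filter_upwards [h] with s hs
      simpa [Finset.sum_range_succ, hm] using hs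
    · exact hm

/-- Uniqueness of partial fraction expansions. -/
lemma partial_fraction_zero {E : Type*} [AddCommGroup E] [Module ℂ E] [TopologicalSpace E]
    [IsTopologicalAddGroup E] [ContinuousSMul ℂ E] [T2Space E] {k : ℕ}
    (lam : Fin k → ℂ) (hlam : Function.Injective lam) (r : Fin k → ℕ)
    (c : Fin k → ℕ → E) (c0 : E)
    (h : ∀ s : ℂ, (∀ i, s ≠ lam i) →
      ∑ i, ∑ j ∈ Finset.range (r i), ((s - lam i) ^ (j + 1))⁻¹ • c i j + c0 = 0) :
    (∀ i, ∀ j < r i, c i j = 0) ∧ c0 = 0 := by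
  have h1 : ∀ i, ∀ j < r i, c i j = 0 := by
    intro i
    apply principal_part_zero (lam i) (c i) (fun s =>
      ∑ l ∈ Finset.univ.erase i, ∑ j ∈ Finset.range (r l), ((s - lam l) ^ (j + 1))⁻¹ • c l j + c0)
    · refine ContinuousAt.add ?_ continuousAt_const
      refine tendsto_finsetSum _ fun l hl => tendsto_finsetSum _ fun j _ => ?_
      have hne : lam i - lam l ≠ 0 :=
        sub_ne_zero.2 fun e => (Finset.ne_of_mem_erase hl) (hlam e).symm
      have : ContinuousAt (fun s : ℂ => ((s - lam l) ^ (j + 1))⁻¹) (lam i) :=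
        ContinuousAt.inv₀ (by fun_prop) (pow_ne_zero _ hne)
      exact this.smul continuousAt_const
    · have hev : ∀ᶠ s in nhdsWithin (lam i) {lam i}ᶜ, ∀ l, s ≠ lam l := by
        rw [Filter.eventually_all]
        intro l
        by_cases hl : l = i
        · subst hl; exact self_mem_nhdsWithin
        · exact nhdsWithin_le_nhds (isOpen_ne.mem_nhds fun e => hl (hlam e).symm)
      filter_upwards [hev] with s hs
      rw [← add_assoc, Finset.add_sum_erase _
        (fun l => ∑ j ∈ Finset.range (r l), ((s - lam l) ^ (j + 1))⁻¹ • c l j) (Finset.mem_univ i)]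
      exact h s hs
  refine ⟨h1, ?_⟩
  obtain ⟨s, hs⟩ := (Set.finite_range lam).exists_notMem
  have := h s fun i e => hs ⟨i, e.symm⟩
  rwa [Finset.sum_eq_zero, zero_add] at this
  intro i _
  apply Finset.sum_eq_zero
  intro j hj
  rw [h1 i j (Finset.mem_range.1 hj), smul_zero]

/-- The column space of `B i 1` equals the generalized eigenspace of `A` for `lam i`. -/
theorem projector_range_eq_generalized_eigenspace
    (n k : ℕ) (hn : 1 ≤ n)
    (A : Matrix (Fin n) (Fin n) ℂ)
    (lam : Fin k → ℂ) (hlam : Function.Injective lam)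
    (r : Fin k → ℕ) (hr : ∀ i, 1 ≤ r i)
    (hsum : ∑ i, r i = n)
    (hchar : A.charpoly = ∏ i, (X - C (lam i)) ^ r i)
    (B : Fin k → ℕ → Matrix (Fin n) (Fin n) ℂ)
    (hB : ∀ s : ℂ, (∀ i, s ≠ lam i) →
      (s • (1 : Matrix (Fin n) (Fin n) ℂ) - A)⁻¹
        = ∑ i, ∑ j ∈ Finset.Icc 1 (r i), ((s - lam i) ^ j)⁻¹ • B i j)
    :
    ∀ i : Fin k,
      {v : Fin n → ℂ | ∃ x : Fin n → ℂ, (B i 1).mulVec x = v}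
        = {v : Fin n → ℂ |
            ((A - lam i • (1 : Matrix (Fin n) (Fin n) ℂ)) ^ r i).mulVec v = 0} := by
  set N : Fin k → Matrix (Fin n) (Fin n) ℂ := fun i => A - lam i • 1 with hN
  set D : Fin k → ℕ → Matrix (Fin n) (Fin n) ℂ :=
    fun i j => if j < r i then B i (j + 1) else 0 with hD
  have hD0 : ∀ i, D i 0 = B i 1 := fun i => by
    have := hr i
    simp only [hD]; rw [if_pos (by omega)]
  have hDr : ∀ i, D i (r i) = 0 := fun i => by simp [hD]
  have key := partial_fraction_zero lam hlam r (fun i j => D i (j + 1) - N i * D i j)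
    (∑ i, D i 0 - 1) (by
      intro s hs
      have hdet : IsUnit (s • (1 : Matrix (Fin n) (Fin n) ℂ) - A).det := by
        have h1 : (s • (1 : Matrix (Fin n) (Fin n) ℂ) - A).det = A.charpoly.eval s := by
          rw [Matrix.eval_charpoly, Matrix.scalar_apply, Matrix.smul_one_eq_diagonal]
        rw [h1, hchar, Polynomial.eval_prod, isUnit_iff_ne_zero, Finset.prod_ne_zero_iff]
        intro i _
        simpa using fun e => absurd e (sub_ne_zero.2 (hs i))
      have h1 := Matrix.mul_nonsing_inv _ hdet
      rw [hB s hs, Finset.mul_sum] at h1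
      rw [← h1, ← Finset.sum_sub_distrib, ← Finset.sum_add_distrib]
      apply Finset.sum_eq_zero
      intro i _
      have hne : s - lam i ≠ 0 := sub_ne_zero.2 (hs i)
      have h2 : ∑ j ∈ Finset.Icc 1 (r i), ((s - lam i) ^ j)⁻¹ • B i j
          = ∑ j ∈ Finset.range (r i), ((s - lam i) ^ (j + 1))⁻¹ • D i j := by
        rw [← Finset.Ico_add_one_right_eq_Icc, Finset.sum_Ico_eq_sum_range]
        apply Finset.sum_congr (by simp)
        intro j hj
        have := Finset.mem_range.1 hj
        simp only [hD]
        rw [if_pos this, add_comm 1 j]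
      have h3 : s • (1 : Matrix (Fin n) (Fin n) ℂ) - A = (s - lam i) • 1 - N i := by
        simp only [hN, sub_smul]; abel
      have h4 : ∑ j ∈ Finset.range (r i), ((s - lam i) ^ (j + 1))⁻¹ • D i (j + 1) + D i 0
          = ∑ j ∈ Finset.range (r i), ((s - lam i) ^ j)⁻¹ • D i j := by
        have e1 := Finset.sum_range_succ' (fun j => ((s - lam i) ^ j)⁻¹ • D i j) (r i)
        rw [Finset.sum_range_succ, hDr] at e1
        simpa using e1.symm
      have h5 : ((s - lam i) • (1 : Matrix (Fin n) (Fin n) ℂ)) *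
          ∑ j ∈ Finset.range (r i), ((s - lam i) ^ (j + 1))⁻¹ • D i j
          = ∑ j ∈ Finset.range (r i), ((s - lam i) ^ j)⁻¹ • D i j := by
        rw [smul_mul_assoc, one_mul, Finset.smul_sum]
        apply Finset.sum_congr rfl
        intro j _
        rw [smul_smul]
        congr 1
        field_simp
        ring
      rw [h2, h3, sub_mul, h5, ← h4, Finset.mul_sum]
      simp only [smul_sub, Finset.sum_sub_distrib, mul_smul_comm]
      abel)
  obtain ⟨hrec, hone⟩ := key
  have hpow : ∀ i, ∀ j ≤ r i, D i j = N i ^ j * B i 1 := by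
    intro i j
    induction j with
    | zero => intro _; simp [hD0]
    | succ j ih =>
      intro hj
      rw [sub_eq_zero.1 (hrec i j (by omega)), ih (by omega), pow_succ', mul_assoc]
  have hkill : ∀ i, N i ^ r i * B i 1 = 0 := fun i => by rw [← hpow i _ le_rfl, hDr]
  have hone' : ∑ i, B i 1 = 1 := by
    rw [← sub_eq_zero, ← hone]; simp only [hD0]
  -- generalized eigenspaces
  have hmem : ∀ i (v : Fin n → ℂ), (N i ^ r i).mulVec v = 0 →
      v ∈ Module.End.maxGenEigenspace (Matrix.toLin' A) (lam i) := by
    intro i v hv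
    rw [Module.End.mem_maxGenEigenspace]
    refine ⟨r i, ?_⟩
    have : Matrix.toLin' A - lam i • (1 : Module.End ℂ (Fin n → ℂ)) = Matrix.toLin' (N i) := by
      simp only [hN, map_sub, map_smul, Matrix.toLin'_one]; rfl
    rw [this, ← Matrix.toLin'_pow, Matrix.toLin'_apply, hv]
  have hBk : ∀ i x, (N i ^ r i).mulVec ((B i 1).mulVec x) = 0 := by
    intro i x
    rw [Matrix.mulVec_mulVec, hkill, Matrix.zero_mulVec]
  have hind := (Module.End.independent_maxGenEigenspace (Matrix.toLin' A)).comp hlam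
  intro i
  ext v
  simp only [Set.mem_ofPred_eq]
  constructor
  · rintro ⟨x, rfl⟩
    exact hBk i x
  · intro hv
    refine ⟨v, ?_⟩
    have hs : (B i 1).mulVec v + ∑ l ∈ Finset.univ.erase i, (B l 1).mulVec v = v := by
      rw [Finset.add_sum_erase _ (fun l => (B l 1).mulVec v) (Finset.mem_univ i),
        ← Matrix.sum_mulVec, hone', Matrix.one_mulVec]
    have hd := hind i
    rw [Submodule.disjoint_def] at hd
    have hz := hd (v - (B i 1).mulVec v)
      (Submodule.sub_mem _ (hmem i v hv) (hmem i _ (hBk i v))) (by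
        rw [← eq_sub_iff_add_eq'.2 hs]
        apply Submodule.sum_mem
        intro l hl
        exact Submodule.mem_iSup_of_mem l (Submodule.mem_iSup_of_mem (Finset.ne_of_mem_erase hl)
          (hmem l _ (hBk l v))))
    exact (sub_eq_zero.1 hz).symm
end
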